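/- Let (X,d) be a complete metric space and p ∈ [1,∞). For two uniform discrete probability measures μ = (1/N)∑_{j=1}^N δ_{x_j} and ν = (1/N)∑_{j=1}^N δ_{y_j} on X, the p-Wasserstein distance satisfies W_p^p(μ,ν) = min over permutations σ of {1,…,N} of (1/N)∑_{j=1}^N d(x_j, y_{σ(j)})^p. -/

import Mathlib

open MeasureTheory Filter Topology ENNReal

/-- The `p`-Wasserstein distance between two measures on a metric space: the infimum
over couplings (measures on `X × X` with the given marginals) of the `p`-th root of the
integral of `d(x,y)^p`. -/
noncomputable def Wp {X : Type*} [MetricSpace X] [MeasurableSpace X] (p : ℝ)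
    (μ ν : Measure X) : ℝ≥0∞ :=
  (⨅ γ ∈ {γ : Measure (X × X) | γ.map Prod.fst = μ ∧ γ.map Prod.snd = ν},
    ∫⁻ z, edist z.1 z.2 ^ p ∂γ) ^ (1 / p)

/-- Real-valued Birkhoff argument. -/
lemma exists_perm_cost_le {N : ℕ} (M C : Fin N → Fin N → ℝ)
    (h0 : ∀ i j, 0 ≤ M i j) (h1 : ∀ i, ∑ j, M i j = 1) (h2 : ∀ j, ∑ i, M i j = 1) :
    ∃ σ : Equiv.Perm (Fin N), ∑ i, C i (σ i) ≤ ∑ i, ∑ j, M i j * C i j := by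
  have hM : (Matrix.of M) ∈ doublyStochastic ℝ (Fin N) := by
    rw [mem_doublyStochastic_iff_sum]
    exact ⟨h0, h1, h2⟩
  obtain ⟨w, hw0, hw1, hw⟩ := exists_eq_sum_perm_of_mem_doublyStochastic hM
  have hMij : ∀ i j, M i j = ∑ σ : Equiv.Perm (Fin N), w σ * (if σ i = j then 1 else 0) := by
    intro i j
    have := congrFun (congrFun hw i) j
    simp only [Matrix.sum_apply, Matrix.smul_apply, smul_eq_mul, Matrix.of_apply] at this
    rw [← this]
    refine Finset.sum_congr rfl fun σ _ => ?_
    simp [Equiv.Perm.permMatrix, PEquiv.toMatrix_apply, eq_comm]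
  have key : ∑ i, ∑ j, M i j * C i j
      = ∑ σ : Equiv.Perm (Fin N), w σ * ∑ i, C i (σ i) := by
    simp_rw [hMij, Finset.sum_mul, Finset.mul_sum]
    rw [Finset.sum_comm' (t' := Finset.univ) (s' := fun _ => Finset.univ) (by simp)]
    rw [Finset.sum_comm]
    rw [Finset.sum_comm (s := (Finset.univ : Finset (Equiv.Perm (Fin N))))]
    refine Finset.sum_congr rfl fun i _ => ?_
    rw [Finset.sum_comm]
    refine Finset.sum_congr rfl fun σ _ => ?_
    simp
  by_contra! hcon
  obtain ⟨σ, -, hσ⟩ := Finset.exists_min_image Finset.univ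
    (fun σ : Equiv.Perm (Fin N) => ∑ i, C i (σ i)) Finset.univ_nonempty
  have h3 : ∑ i, C i (σ i) ≤ ∑ i, ∑ j, M i j * C i j := by
    rw [key]
    calc ∑ i, C i (σ i) = ∑ τ : Equiv.Perm (Fin N), w τ * ∑ i, C i (σ i) := by
          rw [← Finset.sum_mul, hw1, one_mul]
      _ ≤ _ := Finset.sum_le_sum fun τ _ =>
          mul_le_mul_of_nonneg_left (hσ τ (Finset.mem_univ _)) (hw0 τ)
  exact absurd h3 (not_le.mpr (hcon σ))

open Classical in
/-- Summing over indices with weights inverse to the multiplicity. -/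
lemma sum_div_mult {X : Type*} {N : ℕ} (y : Fin N → X) (f : X → ℝ) :
    ∑ j, f (y j) / ((Finset.univ.filter fun k => y k = y j).card : ℝ)
      = ∑ b ∈ Finset.univ.image y, f b := by
  rw [Finset.sum_comp (fun b => f b / ((Finset.univ.filter fun k => y k = b).card : ℝ)) y]
  refine Finset.sum_congr rfl fun b hb => ?_
  obtain ⟨j, -, rfl⟩ := Finset.mem_image.mp hb
  have : ((Finset.univ.filter fun k => y k = y j).card : ℝ) ≠ 0 := by
    rw [Nat.cast_ne_zero]
    exact Finset.card_ne_zero_of_mem (a := j) (by simp)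
  rw [nsmul_eq_mul]
  field_simp

open Classical in
lemma unif_singleton {X : Type*} [MeasurableSpace X] [MeasurableSingletonClass X] {N : ℕ}
    (y : Fin N → X) (b : X) :
    ((N : ℝ≥0∞)⁻¹ • ∑ j, Measure.dirac (y j)) {b}
      = (N : ℝ≥0∞)⁻¹ * ((Finset.univ.filter fun k => y k = b).card : ℝ≥0∞) := by
  simp [Set.indicator_apply]

open Classical in
lemma unif_compl {X : Type*} [MeasurableSpace X] [MeasurableSingletonClass X] {N : ℕ}
    (y : Fin N → X) :
    ((N : ℝ≥0∞)⁻¹ • ∑ j, Measure.dirac (y j)) ((Finset.univ.image y : Finset X) : Set X)ᶜ = 0 := by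
  simp

open Classical in
lemma coupling_lower {X : Type*} [MetricSpace X] [MeasurableSpace X] [BorelSpace X]
    (p : ℝ) (hp : 1 ≤ p) (N : ℕ) (hN : 0 < N) (x y : Fin N → X) (γ : Measure (X × X))
    (h1 : γ.map Prod.fst = (N : ℝ≥0∞)⁻¹ • ∑ j, Measure.dirac (x j))
    (h2 : γ.map Prod.snd = (N : ℝ≥0∞)⁻¹ • ∑ j, Measure.dirac (y j)) :
    ∃ σ : Equiv.Perm (Fin N), (N : ℝ≥0∞)⁻¹ * ∑ j, edist (x j) (y (σ j)) ^ p
      ≤ ∫⁻ z, edist z.1 z.2 ^ p ∂γ := by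
  have hNr : (N : ℝ) ≠ 0 := by positivity
  have hNe : (N : ℝ≥0∞) ≠ 0 := by exact_mod_cast hN.ne'
  set S := Finset.univ.image x with hS
  set T := Finset.univ.image y with hT
  set m : X → ℝ := fun a => ((Finset.univ.filter fun k => x k = a).card : ℝ) with hm
  set n : X → ℝ := fun a => ((Finset.univ.filter fun k => y k = a).card : ℝ) with hn
  have hm0 : ∀ i, m (x i) ≠ 0 := fun i => by
    rw [hm, Nat.cast_ne_zero]; exact Finset.card_ne_zero_of_mem (a := i) (by simp)
  have hn0 : ∀ i, n (y i) ≠ 0 := fun i => by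
    rw [hn, Nat.cast_ne_zero]; exact Finset.card_ne_zero_of_mem (a := i) (by simp)
  have hfin : IsFiniteMeasure γ := by
    constructor
    have : γ Set.univ = (γ.map Prod.fst) Set.univ := by
      rw [Measure.map_apply measurable_fst MeasurableSet.univ, Set.preimage_univ]
    rw [this, h1]
    simp [ENNReal.inv_mul_cancel hNe]
  set g : X → X → ℝ := fun a b => γ.real {(a, b)} with hg
  have hST : γ (Prod.fst ⁻¹' (S : Set X)ᶜ) = 0 := by
    rw [← Measure.map_apply measurable_fst S.measurableSet.compl, h1]
    exact unif_compl x
  have hTT : γ (Prod.snd ⁻¹' (T : Set X)ᶜ) = 0 := by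
    rw [← Measure.map_apply measurable_snd T.measurableSet.compl, h2]
    exact unif_compl y
  have hrow : ∀ a, ∑ b ∈ T, g a b = m a / N := by
    intro a
    have e1 : ∑ b ∈ T, g a b = γ.real (({a} ×ˢ T : Finset (X × X)) : Set (X × X)) := by
      rw [← sum_measureReal_singleton, Finset.sum_product, Finset.sum_singleton]
    have e2 : γ (({a} ×ˢ T : Finset (X × X)) : Set (X × X)) = γ (Prod.fst ⁻¹' {a}) := by
      have : (({a} ×ˢ T : Finset (X × X)) : Set (X × X))
          = Prod.fst ⁻¹' {a} ∩ Prod.snd ⁻¹' (T : Set X) := by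
        ext ⟨u, v⟩
        simp only [Finset.coe_product, Finset.coe_singleton, Set.mem_prod, Set.mem_inter_iff,
          Set.mem_preimage]
      rw [this]
      exact measure_inter_conull hTT
    rw [e1, measureReal_def, e2, ← Measure.map_apply measurable_fst (measurableSet_singleton a),
      h1, unif_singleton]
    simp [hm, div_eq_inv_mul]
  have hcol : ∀ b, ∑ a ∈ S, g a b = n b / N := by
    intro b
    have e1 : ∑ a ∈ S, g a b = γ.real ((S ×ˢ {b} : Finset (X × X)) : Set (X × X)) := by
      rw [← sum_measureReal_singleton, Finset.sum_product]
      simp [hg]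
    have e2 : γ ((S ×ˢ {b} : Finset (X × X)) : Set (X × X)) = γ (Prod.snd ⁻¹' {b}) := by
      have : ((S ×ˢ {b} : Finset (X × X)) : Set (X × X))
          = Prod.snd ⁻¹' {b} ∩ Prod.fst ⁻¹' (S : Set X) := by
        ext ⟨u, v⟩
        simp only [Finset.coe_product, Finset.coe_singleton, Set.mem_prod, Set.mem_inter_iff,
          Set.mem_preimage]
        exact and_comm
      rw [this]
      exact measure_inter_conull hST
    rw [e1, measureReal_def, e2, ← Measure.map_apply measurable_snd (measurableSet_singleton b),
      h2, unif_singleton]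
    simp [hn, div_eq_inv_mul]
  obtain ⟨σ, hσ⟩ := exists_perm_cost_le
    (fun i j => N * (g (x i) (y j) / n (y j) / m (x i))) (fun i j => dist (x i) (y j) ^ p)
    (fun i j => by positivity)
    (fun i => by
      rw [← Finset.mul_sum, ← Finset.sum_div, sum_div_mult y (fun b => g (x i) b), hrow]
      have := hm0 i
      field_simp)
    (fun j => by
      have : ∀ i, g (x i) (y j) / n (y j) / m (x i) = g (x i) (y j) / m (x i) / n (y j) :=
        fun i => div_right_comm _ _ _
      simp_rw [this]
      rw [← Finset.mul_sum, ← Finset.sum_div, sum_div_mult x (fun a => g a (y j)), hcol]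
      have := hn0 j
      field_simp)
  refine ⟨σ, ?_⟩
  have hsum : ∑ i, ∑ j, N * (g (x i) (y j) / n (y j) / m (x i)) * dist (x i) (y j) ^ p
      = N * ∑ z ∈ S ×ˢ T, dist z.1 z.2 ^ p * γ.real {z} := by
    rw [Finset.sum_product, ← sum_div_mult x
      (fun a => ∑ b ∈ T, dist a b ^ p * γ.real {(a, b)}), Finset.mul_sum]
    refine Finset.sum_congr rfl fun i _ => ?_
    rw [← sum_div_mult y (fun b => dist (x i) b ^ p * γ.real {(x i, b)}), Finset.sum_div,
      Finset.mul_sum]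
    refine Finset.sum_congr rfl fun j _ => ?_
    simp only [hg, hm, hn]
    ring
  have hed : ∀ a b : X, edist a b ^ p = ENNReal.ofReal (dist a b ^ p) := fun a b => by
    rw [edist_dist, ENNReal.ofReal_rpow_of_nonneg dist_nonneg (by linarith)]
  calc (N : ℝ≥0∞)⁻¹ * ∑ j, edist (x j) (y (σ j)) ^ p
      = ENNReal.ofReal ((N : ℝ)⁻¹ * ∑ j, dist (x j) (y (σ j)) ^ p) := by
        rw [ENNReal.ofReal_mul (by positivity), ENNReal.ofReal_inv_of_pos (by positivity),
          ENNReal.ofReal_natCast, ENNReal.ofReal_sum_of_nonneg (fun _ _ => by positivity)]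
        simp_rw [hed]
    _ ≤ ENNReal.ofReal (∑ z ∈ S ×ˢ T, dist z.1 z.2 ^ p * γ.real {z}) := by
        apply ENNReal.ofReal_le_ofReal
        rw [hsum] at hσ
        rw [inv_mul_le_iff₀ (by positivity)]
        exact hσ
    _ = ∑ z ∈ S ×ˢ T, edist z.1 z.2 ^ p * γ {z} := by
        rw [ENNReal.ofReal_sum_of_nonneg (fun _ _ => by positivity)]
        refine Finset.sum_congr rfl fun z _ => ?_
        rw [ENNReal.ofReal_mul (by positivity), hed, ofReal_measureReal]
    _ = ∫⁻ z in ((S ×ˢ T : Finset (X × X)) : Set (X × X)), edist z.1 z.2 ^ p ∂γ := by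
        rw [lintegral_finset]
    _ ≤ _ := setLIntegral_le_lintegral _ _

/-- Birkhoff. For uniform discrete probability measures
`μ = (1/N) ∑ δ_{x_j}` and `ν = (1/N) ∑ δ_{y_j}` on a complete metric space,
`W_p^p(μ,ν)` equals the minimum over permutations `σ` of `(1/N) ∑ d(x_j, y_{σ j})^p`. -/
theorem wasserstein_uniform_discrete_matching
    {X : Type*} [MetricSpace X] [CompleteSpace X] [MeasurableSpace X] [BorelSpace X]
    (p : ℝ) (hp : 1 ≤ p) (N : ℕ) (hN : 0 < N) (x y : Fin N → X) :
    (Wp p ((N : ℝ≥0∞)⁻¹ • ∑ j, Measure.dirac (x j))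
          ((N : ℝ≥0∞)⁻¹ • ∑ j, Measure.dirac (y j))) ^ p
      = ⨅ σ : Equiv.Perm (Fin N), (N : ℝ≥0∞)⁻¹ * ∑ j, edist (x j) (y (σ j)) ^ p := by
  have hp0 : p ≠ 0 := by linarith
  unfold Wp
  rw [← ENNReal.rpow_mul, one_div_mul_cancel hp0, ENNReal.rpow_one]
  apply le_antisymm
  · refine le_iInf fun σ => ?_
    refine (iInf₂_le ((N : ℝ≥0∞)⁻¹ • ∑ j, Measure.dirac (x j, y (σ j))) ⟨?_, ?_⟩).trans ?_
    · rw [lintegral_smul_measure, lintegral_finsetSum_measure]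
      simp [lintegral_dirac]
    · rw [Measure.map_smul, ← Measure.mapₗ_apply_of_measurable measurable_fst, map_sum]
      simp [Measure.mapₗ_apply_of_measurable measurable_fst, Measure.map_dirac' measurable_fst]
    · rw [Measure.map_smul, ← Measure.mapₗ_apply_of_measurable measurable_snd, map_sum]
      simp only [Measure.mapₗ_apply_of_measurable measurable_snd,
        Measure.map_dirac' measurable_snd]
      rw [Equiv.sum_comp σ (fun j => Measure.dirac (y j))]
  · refine le_iInf₂ fun γ hγ => ?_
    obtain ⟨σ, hσ⟩ := coupling_lower p hp N hN x y γ hγ.1 hγ.2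
    exact (iInf_le _ σ).trans hσ
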